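/- arXiv:2505.06169 — 2 statements merged into one kernel-verified Lean document; each statement's English description precedes it below -/
import Mathlib

section
/- For every n ≥ 3 there exists a function F : ℝⁿ → ℝ that is CPWL, homogeneous, monotone, convex and has isotonic subgradient, yet F ∉ ReLU⁺_{n,k} for every k; that is, F is not computable by any monotone ReLU network. (For n = 3 one may take F(x) = max{0, x_1, x_2, x_1 + x_2, x_1 + x_2 + x_3}, the support function of the square pyramid with vertices (0,0,0), (1,0,0), (0,1,0), (1,1,0), (1,1,1).) -/
noncomputable section

/-- The rectified linear unit. -/
def relu (t : ℝ) : ℝ := max 0 t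

/-- `ReLUplus n k F` : `F : ℝⁿ → ℝ` is computable by a depth-`k` monotone ReLU network. -/
inductive ReLUplus (n : ℕ) : ℕ → ((Fin n → ℝ) → ℝ) → Prop
  | affine (a : Fin n → ℝ) (b : ℝ) (ha : ∀ i, 0 ≤ a i) :
      ReLUplus n 0 (fun x => (∑ i, a i * x i) + b)
  | comb {k : ℕ} {F G : (Fin n → ℝ) → ℝ} (c c' b : ℝ) (hc : 0 ≤ c) (hc' : 0 ≤ c')
      (hF : ReLUplus n k F) (hG : ReLUplus n k G) :
      ReLUplus n k (fun x => c * F x + c' * G x + b)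
  | act {k : ℕ} {F : (Fin n → ℝ) → ℝ} (hF : ReLUplus n k F) :
      ReLUplus n (k + 1) (fun x => relu (F x))
  | deepen {k : ℕ} {F : (Fin n → ℝ) → ℝ} (hF : ReLUplus n k F) :
      ReLUplus n (k + 1) F

/-- The subgradient of `F` at `x`: all `g` with `F y ≥ F x + ⟨g, y − x⟩` for all `y`. -/
def subgrad {n : ℕ} (F : (Fin n → ℝ) → ℝ) (x : Fin n → ℝ) : Set (Fin n → ℝ) :=
  {g | ∀ y : Fin n → ℝ, F x + ∑ i, g i * (y i - x i) ≤ F y}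

/-- `A ≤ B` for sets: every `a ∈ A` has `b ∈ B` with `a ≤ b`, and every `b ∈ B`
has `a ∈ A` with `a ≤ b` (coordinatewise order). -/
def SetLE {n : ℕ} (A B : Set (Fin n → ℝ)) : Prop :=
  (∀ a ∈ A, ∃ b ∈ B, a ≤ b) ∧ (∀ b ∈ B, ∃ a ∈ A, a ≤ b)

/-- `F` has isotonic subgradient: `∂F(x) ≤ ∂F(y)` whenever `x ≤ y`. -/
def IsotonicSubgrad {n : ℕ} (F : (Fin n → ℝ) → ℝ) : Prop :=
  ∀ x y : Fin n → ℝ, x ≤ y → SetLE (subgrad F x) (subgrad F y)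

/-- `F : ℝⁿ → ℝ` is continuous piecewise affine with finitely many pieces. -/
def IsCPWL {n : ℕ} (F : (Fin n → ℝ) → ℝ) : Prop :=
  Continuous F ∧ ∃ s : Finset ((Fin n → ℝ) × ℝ),
    ∀ x : Fin n → ℝ, ∃ p ∈ s, F x = (∑ i, p.1 i * x i) + p.2

/-- The support function of the square pyramid, as a function of three real variables. -/
def pyr (a b c : ℝ) : ℝ := max (max 0 a + max 0 b) (a + b + c)

/-- The support function of the square pyramid on `ℝ³`. -/
def pyrVec (u : Fin 3 → ℝ) : ℝ := pyr (u 0) (u 1) (u 2)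

theorem pyr_eq_left {a b c : ℝ} (h : a + b + c ≤ max 0 a + max 0 b) :
    pyr a b c = max 0 a + max 0 b := max_eq_left h

theorem pyr_eq_right {a b c : ℝ} (h : max 0 a + max 0 b ≤ a + b + c) :
    pyr a b c = a + b + c := max_eq_right h

theorem pyr_nonneg (a b c : ℝ) : 0 ≤ pyr a b c :=
  le_max_of_le_left (add_nonneg (le_max_left _ _) (le_max_left _ _))

theorem pyr_mono {a b c a' b' c' : ℝ} (ha : a ≤ a') (hb : b ≤ b') (hc : c ≤ c') :
    pyr a b c ≤ pyr a' b' c' := by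
  unfold pyr
  gcongr

theorem pyr_smul {t : ℝ} (ht : 0 ≤ t) (a b c : ℝ) :
    pyr (t * a) (t * b) (t * c) = t * pyr a b c := by
  unfold pyr
  rw [mul_max_of_nonneg _ _ ht, mul_add, mul_max_of_nonneg _ _ ht, mul_max_of_nonneg _ _ ht]
  ring_nf

theorem pyr_add_le (a b c a' b' c' : ℝ) :
    pyr (a + a') (b + b') (c + c') ≤ pyr a b c + pyr a' b' c' := by
  unfold pyr
  have h1 := le_max_left (max 0 a + max 0 b) (a + b + c)
  have h2 := le_max_right (max 0 a + max 0 b) (a + b + c)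
  have h3 := le_max_left (max 0 a' + max 0 b') (a' + b' + c')
  have h4 := le_max_right (max 0 a' + max 0 b') (a' + b' + c')
  refine max_le ?_ (by linarith)
  have h5 : max 0 (a + a') ≤ max 0 a + max 0 a' := by
    simpa using max_add_add_le_max_add_max (a := (0 : ℝ)) (b := 0) (c := a) (d := a')
  have h6 : max 0 (b + b') ≤ max 0 b + max 0 b' := by
    simpa using max_add_add_le_max_add_max (a := (0 : ℝ)) (b := 0) (c := b) (d := b')
  linarith

theorem pyrVec_vec (x y z : ℝ) : pyrVec ![x, y, z] = pyr x y z := rfl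

theorem pyrVec_smul {t : ℝ} (ht : 0 ≤ t) (u : Fin 3 → ℝ) : pyrVec (t • u) = t * pyrVec u := by
  simpa [pyrVec] using pyr_smul ht (u 0) (u 1) (u 2)

theorem pyrVec_add_le (u v : Fin 3 → ℝ) : pyrVec (u + v) ≤ pyrVec u + pyrVec v := by
  simpa [pyrVec] using pyr_add_le (u 0) (u 1) (u 2) (v 0) (v 1) (v 2)

/-- Increments of `G` in nonnegative directions are monotone in the base point. -/
def Ultramodular {n : ℕ} (G : (Fin n → ℝ) → ℝ) : Prop :=
  ∀ x y h : Fin n → ℝ, x ≤ y → 0 ≤ h → G (x + h) - G x ≤ G (y + h) - G y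

theorem relu_nonneg (t : ℝ) : 0 ≤ relu t := le_max_left _ _

theorem relu_mono : Monotone relu := fun _ _ h => max_le_max le_rfl h

theorem relu_convexOn : ConvexOn ℝ Set.univ relu := by
  have h := (convexOn_const (0 : ℝ) (convex_univ (𝕜 := ℝ) (E := ℝ))).sup
    (convexOn_id (convex_univ (𝕜 := ℝ) (E := ℝ)))
  exact h

theorem relu_increment {p q r s : ℝ} (hpr : p ≤ r) (hpq : p ≤ q) (h : q - p ≤ s - r) :
    relu q - relu p ≤ relu s - relu r := by
  unfold relu
  rcases max_cases 0 p with ⟨h1, _⟩ | ⟨h1, _⟩ <;> rcases max_cases 0 q with ⟨h2, _⟩ | ⟨h2, _⟩ <;>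
  rcases max_cases 0 r with ⟨h3, _⟩ | ⟨h3, _⟩ <;> rcases max_cases 0 s with ⟨h4, _⟩ | ⟨h4, _⟩ <;>
  linarith

theorem ReLUplus.monotone {n k : ℕ} {G : (Fin n → ℝ) → ℝ} (hG : ReLUplus n k G) :
    Monotone G := by
  induction hG with
  | affine a b ha =>
    intro x y hxy
    have : ∑ i, a i * x i ≤ ∑ i, a i * y i :=
      Finset.sum_le_sum fun i _ => mul_le_mul_of_nonneg_left (hxy i) (ha i)
    simpa using this
  | comb c c' b hc hc' _ _ hF hG =>
    intro x y hxy
    have h1 := mul_le_mul_of_nonneg_left (hF hxy) hc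
    have h2 := mul_le_mul_of_nonneg_left (hG hxy) hc'
    simp only
    linarith
  | act _ hF => exact relu_mono.comp hF
  | deepen _ hF => exact hF

theorem ReLUplus.ultramodular {n k : ℕ} {G : (Fin n → ℝ) → ℝ} (hG : ReLUplus n k G) :
    Ultramodular G := by
  induction hG with
  | affine a b ha =>
    intro x y h _ _
    simp [mul_add, Finset.sum_add_distrib]
  | comb c c' b hc hc' _ _ hF hG =>
    intro x y h hxy hh
    have h1 := mul_le_mul_of_nonneg_left (hF x y h hxy hh) hc
    have h2 := mul_le_mul_of_nonneg_left (hG x y h hxy hh) hc'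
    simp only
    linarith
  | act hF ih =>
    intro x y h hxy hh
    exact relu_increment (hF.monotone hxy) (hF.monotone (le_add_of_nonneg_right hh))
      (ih x y h hxy hh)
  | deepen _ hF => exact hF

theorem ReLUplus.convexOn {n k : ℕ} {G : (Fin n → ℝ) → ℝ} (hG : ReLUplus n k G) :
    ConvexOn ℝ Set.univ G := by
  induction hG with
  | affine a b ha =>
    refine ⟨convex_univ, fun x _ y _ s t _ _ hst => le_of_eq ?_⟩
    have h : ∀ i, a i * (s * x i + t * y i) = s * (a i * x i) + t * (a i * y i) :=
      fun i => by ring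
    simp only [Pi.add_apply, Pi.smul_apply, smul_eq_mul, h, Finset.sum_add_distrib,
      ← Finset.mul_sum]
    linear_combination (-b) * hst
  | comb c c' b hc hc' _ _ hF hG =>
    exact ((hF.smul hc).add (hG.smul hc')).add_const b
  | act hF ih =>
    refine ⟨convex_univ, fun x _ y _ s t hs ht hst => ?_⟩
    exact (relu_mono (ih.2 trivial trivial hs ht hst)).trans
      (relu_convexOn.2 trivial trivial hs ht hst)
  | deepen _ hF => exact hF

/-- `K` is affine along every segment on which `pyrVec` is affine. -/
def PyramidTight (K : (Fin 3 → ℝ) → ℝ) : Prop :=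
  ∀ (u v : Fin 3 → ℝ) (s t : ℝ), 0 ≤ s → 0 ≤ t → s + t = 1 →
    pyrVec (s • u + t • v) = s * pyrVec u + t * pyrVec v →
    K (s • u + t • v) = s * K u + t * K v

/-- A linear functional that vanishes on affine functions and takes the value `1` at `pyrVec`. -/
def pyramidCoeff (K : (Fin 3 → ℝ) → ℝ) : ℝ :=
  K ![1, 0, 0] + K ![-1, 0, 1] + K ![0, 0, -1] - 3 * K 0

namespace PyramidTight

variable {K : (Fin 3 → ℝ) → ℝ}

theorem smul (hK : PyramidTight K) {t : ℝ} (ht : 0 ≤ t) (u : Fin 3 → ℝ) :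
    K (t • u) - K 0 = t * (K u - K 0) := by
  have small : ∀ (t : ℝ) (u : Fin 3 → ℝ), 0 ≤ t → t ≤ 1 →
      K (t • u) - K 0 = t * (K u - K 0) := by
    intro t u h0 h1
    have h := hK u 0 t (1 - t) h0 (by linarith) (by ring)
    have hz : pyrVec 0 = 0 := by simp [pyrVec, pyr]
    simp only [smul_zero, add_zero, pyrVec_smul h0, hz, mul_zero, forall_const] at h
    linarith
  rcases le_total t 1 with h1 | h1
  · exact small t u ht h1
  · have hpos : 0 < t := by linarith
    have h := small t⁻¹ (t • u) (by positivity) (inv_le_one_of_one_le₀ h1)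
    rw [smul_smul, inv_mul_cancel₀ hpos.ne', one_smul] at h
    rw [h]
    field_simp

theorem add (hK : PyramidTight K) {u v : Fin 3 → ℝ}
    (h : pyrVec (u + v) = pyrVec u + pyrVec v) :
    K (u + v) - K 0 = (K u - K 0) + (K v - K 0) := by
  have e : (1 / 2 : ℝ) • u + (1 / 2 : ℝ) • v = (1 / 2 : ℝ) • (u + v) := by rw [smul_add]
  have h1 := hK u v (1 / 2) (1 / 2) (by norm_num) (by norm_num) (by norm_num)
    (by rw [e, pyrVec_smul (by norm_num), h]; ring)
  have h2 := hK.smul (t := 1 / 2) (by norm_num) (u + v)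
  rw [e] at h1
  linarith

theorem cone (hK : PyramidTight K) {a b c : Fin 3 → ℝ} {α β γ : ℝ} (hα : 0 ≤ α) (hβ : 0 ≤ β)
    (hγ : 0 ≤ γ) {u : Fin 3 → ℝ} (hu : u = α • a + β • b + γ • c)
    (h : pyrVec u = α * pyrVec a + β * pyrVec b + γ * pyrVec c) :
    K u - K 0 = α * (K a - K 0) + β * (K b - K 0) + γ * (K c - K 0) := by
  subst hu
  have h1 := pyrVec_add_le (α • a) (β • b)
  have h2 := pyrVec_add_le (α • a + β • b) (γ • c)
  have ea := pyrVec_smul hα a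
  have eb := pyrVec_smul hβ b
  have ec := pyrVec_smul hγ c
  rw [hK.add (by linarith), hK.add (by linarith), hK.smul hα, hK.smul hβ, hK.smul hγ]

/-- The square pyramid is indecomposable. -/
theorem eq_affine_add (hK : PyramidTight K) : ∃ l₁ l₂ l₃ : ℝ, ∀ x y z : ℝ,
    K ![x, y, z] = pyramidCoeff K * pyr x y z + (l₁ * x + l₂ * y + l₃ * z) + K 0 := by
  have hd : pyrVec ![0, 0, -1] = 0 := by norm_num [pyrVec_vec, pyr]
  have hp : pyrVec ![0, -1, 1] = 0 := by norm_num [pyrVec_vec, pyr]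
  have hq : pyrVec ![-1, 0, 1] = 0 := by norm_num [pyrVec_vec, pyr]
  have he : pyrVec ![1, 0, 0] = 1 := by norm_num [pyrVec_vec, pyr]
  have hf : pyrVec ![0, 1, 0] = 1 := by norm_num [pyrVec_vec, pyr]
  have hr : pyrVec ![0, 0, 1] = 1 := by norm_num [pyrVec_vec, pyr]
  have r1 : K ![0, 0, 1] - K 0 = (K ![0, -1, 1] - K 0) + (K ![0, 1, 0] - K 0) := by
    have e : (![0, 0, 1] : Fin 3 → ℝ) = ![0, -1, 1] + ![0, 1, 0] := by simp
    have h := hK.add (u := ![0, -1, 1]) (v := ![0, 1, 0])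
    rw [← e] at h
    exact h (by rw [hr, hp, hf]; norm_num)
  have r2 : K ![0, 0, 1] - K 0 = (K ![-1, 0, 1] - K 0) + (K ![1, 0, 0] - K 0) := by
    have e : (![0, 0, 1] : Fin 3 → ℝ) = ![-1, 0, 1] + ![1, 0, 0] := by simp
    have h := hK.add (u := ![-1, 0, 1]) (v := ![1, 0, 0])
    rw [← e] at h
    exact h (by rw [hr, hq, he]; norm_num)
  generalize hD : K ![0, 0, -1] - K 0 = D at *
  generalize hP : K ![0, -1, 1] - K 0 = P at *
  generalize hQ : K ![-1, 0, 1] - K 0 = Q at *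
  generalize hE : K ![1, 0, 0] - K 0 = E at *
  generalize hE' : K ![0, 1, 0] - K 0 = E' at *
  generalize hR : K ![0, 0, 1] - K 0 = R at *
  have hco : pyramidCoeff K = E + Q + D := by unfold pyramidCoeff; linarith
  refine ⟨-D - Q, -D - P, -D, fun x y z => ?_⟩
  have key : ∀ {a b c : Fin 3 → ℝ} {α β γ : ℝ}, 0 ≤ α → 0 ≤ β → 0 ≤ γ →
      ![x, y, z] = α • a + β • b + γ • c →
      pyr x y z = α * pyrVec a + β * pyrVec b + γ * pyrVec c →
      K ![x, y, z] - K 0 = α * (K a - K 0) + β * (K b - K 0) + γ * (K c - K 0) :=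
    fun h1 h2 h3 h4 h5 => hK.cone h1 h2 h3 h4 (by rw [pyrVec_vec, h5])
  rw [hco]
  rcases le_total x 0 with hx | hx <;> rcases le_total y 0 with hy | hy
  · rcases le_total (x + y + z) 0 with hz | hz
    · have hv : pyr x y z = 0 := by
        rw [pyr_eq_left] <;> simp [hx, hy, hz]
      have h := key (a := ![0, 0, -1]) (b := ![0, -1, 1]) (c := ![-1, 0, 1])
        (α := -(x + y + z)) (β := -y) (γ := -x) (by linarith) (by linarith) (by linarith)
        (by ext i; fin_cases i <;> simp; ring) (by rw [hv, hd, hp, hq]; ring)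
      rw [hD, hP, hQ] at h
      rw [hv]
      linear_combination h
    · have hv : pyr x y z = x + y + z := by
        rw [pyr_eq_right]; simp [hx, hy, hz]
      have h := key (a := ![0, 0, 1]) (b := ![0, -1, 1]) (c := ![-1, 0, 1])
        (α := x + y + z) (β := -y) (γ := -x) (by linarith) (by linarith) (by linarith)
        (by ext i; fin_cases i <;> simp; ring) (by rw [hv, hr, hp, hq]; ring)
      rw [hR, hP, hQ] at h
      rw [hv]
      linear_combination h + (x + y + z) * r2
  · rcases le_total (x + z) 0 with hz | hz
    · have hv : pyr x y z = y := by
        rw [pyr_eq_left] <;> simp [hx, hy]; linarith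
      have h := key (a := ![0, 0, -1]) (b := ![-1, 0, 1]) (c := ![0, 1, 0])
        (α := -(x + z)) (β := -x) (γ := y) (by linarith) (by linarith) (by linarith)
        (by ext i; fin_cases i <;> simp) (by rw [hv, hd, hq, hf]; ring)
      rw [hD, hQ, hE'] at h
      rw [hv]
      linear_combination h + y * (r2 - r1)
    · have hv : pyr x y z = x + y + z := by
        rw [pyr_eq_right]; simp [hx, hy]; linarith
      have h := key (a := ![0, 0, 1]) (b := ![-1, 0, 1]) (c := ![0, 1, 0])
        (α := x + z) (β := -x) (γ := y) (by linarith) (by linarith) (by linarith)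
        (by ext i; fin_cases i <;> simp) (by rw [hv, hr, hq, hf]; ring)
      rw [hR, hQ, hE'] at h
      rw [hv]
      linear_combination h + (x + y + z) * r2 - y * r1
  · rcases le_total (y + z) 0 with hz | hz
    · have hv : pyr x y z = x := by
        rw [pyr_eq_left] <;> simp [hx, hy]; linarith
      have h := key (a := ![0, 0, -1]) (b := ![0, -1, 1]) (c := ![1, 0, 0])
        (α := -(y + z)) (β := -y) (γ := x) (by linarith) (by linarith) (by linarith)
        (by ext i; fin_cases i <;> simp) (by rw [hv, hd, hp, he]; ring)
      rw [hD, hP, hE] at h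
      rw [hv]
      linear_combination h
    · have hv : pyr x y z = x + y + z := by
        rw [pyr_eq_right]; simp [hx, hy]; linarith
      have h := key (a := ![0, 0, 1]) (b := ![0, -1, 1]) (c := ![1, 0, 0])
        (α := y + z) (β := -y) (γ := x) (by linarith) (by linarith) (by linarith)
        (by ext i; fin_cases i <;> simp) (by rw [hv, hr, hp, he]; ring)
      rw [hR, hP, hE] at h
      rw [hv]
      linear_combination h + (y + z) * r2
  · rcases le_total z 0 with hz | hz
    · have hv : pyr x y z = x + y := by
        rw [pyr_eq_left] <;> simp [hx, hy, hz]
      have h := key (a := ![0, 0, -1]) (b := ![1, 0, 0]) (c := ![0, 1, 0])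
        (α := -z) (β := x) (γ := y) (by linarith) (by linarith) (by linarith)
        (by ext i; fin_cases i <;> simp) (by rw [hv, hd, he, hf]; ring)
      rw [hD, hE, hE'] at h
      rw [hv]
      linear_combination h + y * (r2 - r1)
    · have hv : pyr x y z = x + y + z := by
        rw [pyr_eq_right]; simp [hx, hy, hz]
      have h := key (a := ![0, 0, 1]) (b := ![1, 0, 0]) (c := ![0, 1, 0])
        (α := z) (β := x) (γ := y) (by linarith) (by linarith) (by linarith)
        (by ext i; fin_cases i <;> simp) (by rw [hv, hr, he, hf]; ring)
      rw [hR, hE, hE'] at h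
      rw [hv]
      linear_combination h + (y + z) * r2 - y * r1

end PyramidTight

/-- If `relu ∘ G` is a positive multiple of `pyrVec`, then `G` is already nonnegative. -/
theorem nonneg_of_relu_eq_pyr {G : (Fin 3 → ℝ) → ℝ} (hm : Monotone G) (hu : Ultramodular G)
    (hc : ConvexOn ℝ Set.univ G) {r : ℝ} (hr : 0 < r)
    (h : ∀ x y z, relu (G ![x, y, z]) = r * pyr x y z) (x y z : ℝ) : 0 ≤ G ![x, y, z] := by
  have hpos : ∀ x y z, 0 < pyr x y z → G ![x, y, z] = r * pyr x y z := by
    intro x y z hp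
    have h1 := h x y z
    have h2 : 0 < r * pyr x y z := mul_pos hr hp
    rw [← h1] at h2 ⊢
    exact (max_eq_right ((lt_max_iff.1 h2).resolve_left (lt_irrefl 0)).le).symm
  rcases (pyr_nonneg x y z).lt_or_eq with hp | hp
  · rw [hpos x y z hp]
    positivity
  have hx : x ≤ 0 := by
    by_contra! hx
    have : max 0 x + max 0 y ≤ pyr x y z := le_max_left _ _
    have := le_max_right 0 x
    have := le_max_left 0 y
    linarith
  have hy : y ≤ 0 := by
    by_contra! hy
    have : max 0 x + max 0 y ≤ pyr x y z := le_max_left _ _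
    have := le_max_left 0 x
    have := le_max_right 0 y
    linarith
  set w := min z 0 with hw
  have hw0 : w ≤ 0 := min_le_right _ _
  have v1 : ∀ t y', 0 < t → y' ≤ 0 → G ![t, y', w] = r * t := by
    intro t y' ht hy'
    have hv : pyr t y' w = t := by
      rw [pyr_eq_left] <;> simp [ht.le, hy']; linarith
    rw [hpos _ _ _ (by rw [hv]; exact ht), hv]
  have v2 : ∀ x', x' ≤ 0 → G ![x', 1, w] = r * 1 := by
    intro x' hx'
    have hv : pyr x' 1 w = 1 := by
      rw [pyr_eq_left] <;> simp [hx']; linarith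
    rw [hpos _ _ _ (by rw [hv]; exact one_pos), hv]
  have o : 0 ≤ G ![0, 0, w] := by
    have h1 := hc.2 (Set.mem_univ ![0, 0, w]) (Set.mem_univ ![2, 0, w])
      (show (0 : ℝ) ≤ 1 / 2 by norm_num) (show (0 : ℝ) ≤ 1 / 2 by norm_num) (by norm_num)
    have e : (1 / 2 : ℝ) • ![0, 0, w] + (1 / 2 : ℝ) • ![2, 0, w] = ![1, 0, w] := by
      ext i; fin_cases i <;> simp; ring
    rw [e, v1 1 0 one_pos le_rfl, v1 2 0 two_pos le_rfl] at h1
    simp only [smul_eq_mul] at h1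
    linarith
  have s1 : G ![x, 0, w] ≤ G ![x, y, w] := by
    have h1 := hu ![x, y, w] ![1, y, w] ![0, -y, 0]
      (by intro i; fin_cases i <;> simp; linarith) (by intro i; fin_cases i <;> simp [hy])
    have e1 : (![x, y, w] : Fin 3 → ℝ) + ![0, -y, 0] = ![x, 0, w] := by simp
    have e2 : (![1, y, w] : Fin 3 → ℝ) + ![0, -y, 0] = ![1, 0, w] := by simp
    rw [e1, e2, v1 1 0 one_pos le_rfl, v1 1 y one_pos hy] at h1
    linarith
  have s2 : G ![0, 0, w] ≤ G ![x, 0, w] := by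
    have h1 := hu ![x, 0, w] ![x, 1, w] ![-x, 0, 0]
      (by intro i; fin_cases i <;> simp) (by intro i; fin_cases i <;> simp [hx])
    have e1 : (![x, 0, w] : Fin 3 → ℝ) + ![-x, 0, 0] = ![0, 0, w] := by simp
    have e2 : (![x, 1, w] : Fin 3 → ℝ) + ![-x, 0, 0] = ![0, 1, w] := by simp
    rw [e1, e2, v2 0 le_rfl, v2 x hx] at h1
    linarith
  have s3 : G ![x, y, w] ≤ G ![x, y, z] :=
    hm (by intro i; fin_cases i <;> simp [hw])
  linarith

theorem relu_comp_eq_self {G : (Fin 3 → ℝ) → ℝ} (hm : Monotone G) (hu : Ultramodular G)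
    (hc : ConvexOn ℝ Set.univ G) (ht : PyramidTight fun x => relu (G x))
    (hpos : 0 < pyramidCoeff fun x => relu (G x)) : (fun x => relu (G x)) = G := by
  obtain ⟨l₁, l₂, l₃, h⟩ := ht.eq_affine_add
  set r := pyramidCoeff fun x => relu (G x)
  set b := relu (G 0)
  have hmono : Monotone fun x => relu (G x) := relu_mono.comp hm
  have hb : 0 ≤ b := relu_nonneg _
  have n1 : 0 ≤ l₁ := by
    have h1 := hmono (a := ![-1, 0, 0]) (b := ![0, 0, 0]) (by intro i; fin_cases i <;> simp)
    simp only [h] at h1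
    norm_num [pyr] at h1
    exact h1
  have n2 : 0 ≤ l₂ := by
    have h1 := hmono (a := ![0, -1, 0]) (b := ![0, 0, 0]) (by intro i; fin_cases i <;> simp)
    simp only [h] at h1
    norm_num [pyr] at h1
    exact h1
  have n3 : 0 ≤ l₃ := by
    have h1 := hmono (a := ![0, 0, -1]) (b := ![0, 0, 0]) (by intro i; fin_cases i <;> simp)
    simp only [h] at h1
    norm_num [pyr] at h1
    exact h1
  have hs : l₁ + l₂ + l₃ ≤ 0 := by
    by_contra! hs
    set t := (b + 1) / (l₁ + l₂ + l₃) with ht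
    have ht0 : 0 ≤ t := by positivity
    have htS : t * (l₁ + l₂ + l₃) = b + 1 := div_mul_cancel₀ _ hs.ne'
    have h1 := h (-t) (-t) (-t)
    have hv : pyr (-t) (-t) (-t) = 0 := by
      rw [pyr_eq_left] <;> simp [ht0]; linarith
    have h2 := relu_nonneg (G ![-t, -t, -t])
    rw [h1, hv] at h2
    linarith
  have z1 : l₁ = 0 := by linarith
  have z2 : l₂ = 0 := by linarith
  have z3 : l₃ = 0 := by linarith
  subst z1 z2 z3
  simp only [zero_mul, add_zero] at h
  funext u
  refine max_eq_right ?_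
  have eu : u = ![u 0, u 1, u 2] := by ext i; fin_cases i <;> rfl
  rw [eu]
  rcases hb.lt_or_eq with hb | hb
  · have h1 := h (u 0) (u 1) (u 2)
    have h2 : 0 < relu (G ![u 0, u 1, u 2]) := by
      rw [h1]
      have := mul_nonneg hpos.le (pyr_nonneg (u 0) (u 1) (u 2))
      linarith
    exact ((lt_max_iff.1 h2).resolve_left (lt_irrefl 0)).le
  · exact nonneg_of_relu_eq_pyr hm hu hc hpos (fun x y z => by rw [h, ← hb, add_zero]) _ _ _

theorem PyramidTight.of_comb {F G : (Fin 3 → ℝ) → ℝ} {c c' b : ℝ} (hc : 0 < c) (hc' : 0 ≤ c')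
    (hF : ConvexOn ℝ Set.univ F) (hG : ConvexOn ℝ Set.univ G)
    (h : PyramidTight fun x => c * F x + c' * G x + b) : PyramidTight F := by
  intro u v s t hs ht hst huv
  have h1 := h u v s t hs ht hst huv
  have h2 := hF.2 (Set.mem_univ u) (Set.mem_univ v) hs ht hst
  have h3 := mul_le_mul_of_nonneg_left (hG.2 (Set.mem_univ u) (Set.mem_univ v) hs ht hst) hc'
  simp only [smul_eq_mul] at h1 h2 h3
  refine le_antisymm h2 (le_of_mul_le_mul_left ?_ hc)
  linear_combination h3 - h1 - b * hst

theorem ReLUplus.pyramidCoeff_nonpos {k : ℕ} {K : (Fin 3 → ℝ) → ℝ} (hK : ReLUplus 3 k K)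
    (ht : PyramidTight K) : pyramidCoeff K ≤ 0 := by
  induction hK with
  | affine a b ha =>
    simp [pyramidCoeff, Fin.sum_univ_three]
    linarith
  | @comb k F G c c' b hc hc' hF hG ihF ihG =>
    have e : pyramidCoeff (fun x => c * F x + c' * G x + b)
        = c * pyramidCoeff F + c' * pyramidCoeff G := by
      unfold pyramidCoeff; ring
    rw [e]
    have h1 : c * pyramidCoeff F ≤ 0 := by
      rcases hc.lt_or_eq with hc | hc
      · exact mul_nonpos_of_nonneg_of_nonpos hc.le
          (ihF (.of_comb hc hc' hF.convexOn hG.convexOn ht))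
      · simp [← hc]
    have h2 : c' * pyramidCoeff G ≤ 0 := by
      rcases hc'.lt_or_eq with hc' | hc'
      · refine mul_nonpos_of_nonneg_of_nonpos hc'.le
          (ihG (.of_comb (b := b) hc' hc hG.convexOn hF.convexOn ?_))
        simpa only [add_comm (c * F _)] using ht
      · simp [← hc']
    linarith
  | act hF ih =>
    by_contra! hpos
    have e := relu_comp_eq_self hF.monotone hF.ultramodular hF.convexOn ht hpos
    rw [e] at ht hpos
    exact absurd (ih ht) (not_le.2 hpos)
  | deepen _ ih => exact ih ht

theorem fin_zero_ne_two (m : ℕ) : (0 : Fin (m + 3)) ≠ 2 := ne_of_beq_false rfl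

theorem fin_one_ne_two (m : ℕ) : (1 : Fin (m + 3)) ≠ 2 := ne_of_beq_false rfl

/-- The point of `ℝᵐ⁺³` with the given first three coordinates and zeros elsewhere. -/
def padVec (m : ℕ) (a b c : ℝ) : Fin (m + 3) → ℝ :=
  Fin.cons a (Fin.cons b (Fin.cons c 0))

@[simp] theorem padVec_zero (m : ℕ) (a b c : ℝ) : padVec m a b c 0 = a := rfl

@[simp] theorem padVec_one (m : ℕ) (a b c : ℝ) : padVec m a b c 1 = b := rfl

@[simp] theorem padVec_two (m : ℕ) (a b c : ℝ) : padVec m a b c 2 = c := rfl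

theorem padVec_sum (m : ℕ) (a b c : ℝ) (x : Fin (m + 3) → ℝ) :
    ∑ i, padVec m a b c i * x i = a * x 0 + b * x 1 + c * x 2 := by
  simp [padVec, Fin.sum_univ_succ, add_assoc]

theorem forall_fin_add_three {m : ℕ} {p : Fin (m + 3) → Prop} (h0 : p 0) (h1 : p 1) (h2 : p 2)
    (h : ∀ i : Fin m, p i.succ.succ.succ) (i : Fin (m + 3)) : p i :=
  Fin.cases h0 (Fin.cases h1 (Fin.cases h2 h)) i

theorem ReLUplus.comp_padVec {m k : ℕ} {K : (Fin (m + 3) → ℝ) → ℝ} (hK : ReLUplus (m + 3) k K) :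
    ReLUplus 3 k fun u => K (padVec m (u 0) (u 1) (u 2)) := by
  induction hK with
  | affine a b ha =>
    have h := ReLUplus.affine (n := 3) ![a 0, a 1, a 2] b
      (by intro i; fin_cases i <;> simp [ha])
    convert h using 3 with u
    simp only [mul_comm (a _)]
    rw [padVec_sum]
    simp [Fin.sum_univ_three, mul_comm]
  | comb c c' b hc hc' _ _ hF hG => exact .comb c c' b hc hc' hF hG
  | act _ hF => exact .act hF
  | deepen _ hF => exact .deepen hF

/-- The support function of the square pyramid, as a function on `ℝᵐ⁺³`. -/
def pyrFun (m : ℕ) (x : Fin (m + 3) → ℝ) : ℝ := pyr (x 0) (x 1) (x 2)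

theorem pyrFun_not_ReLUplus (m k : ℕ) : ¬ ReLUplus (m + 3) k (pyrFun m) := by
  intro h
  have h1 : ReLUplus 3 k pyrVec := h.comp_padVec
  have h0 : pyrVec 0 = 0 := by simp [pyrVec, pyr]
  have h2 := h1.pyramidCoeff_nonpos fun _ _ _ _ _ _ _ h => h
  norm_num [pyramidCoeff, pyrVec_vec, pyr, h0] at h2

theorem pyrFun_isCPWL (m : ℕ) : IsCPWL (pyrFun m) := by
  classical
  refine ⟨by unfold pyrFun pyr; fun_prop, {(padVec m 0 0 0, 0), (padVec m 1 0 0, 0),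
    (padVec m 0 1 0, 0), (padVec m 1 1 0, 0), (padVec m 1 1 1, 0)}, fun x => ?_⟩
  simp only [Finset.mem_insert, Finset.mem_singleton, exists_eq_or_imp, exists_eq_left,
    padVec_sum, pyrFun, pyr]
  rcases max_cases (max 0 (x 0) + max 0 (x 1)) (x 0 + x 1 + x 2) with ⟨h, _⟩ | ⟨h, _⟩ <;>
  rcases max_cases 0 (x 0) with ⟨h1, _⟩ | ⟨h1, _⟩ <;>
  rcases max_cases 0 (x 1) with ⟨h2, _⟩ | ⟨h2, _⟩ <;> rw [h] <;> simp [h1, h2]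

theorem pyrFun_convexOn (m : ℕ) : ConvexOn ℝ Set.univ (pyrFun m) := by
  refine ⟨convex_univ, fun x _ y _ s t hs ht _ => ?_⟩
  have h := pyr_add_le (s * x 0) (s * x 1) (s * x 2) (t * y 0) (t * y 1) (t * y 2)
  rwa [pyr_smul hs, pyr_smul ht] at h

section Subgradient

variable {m : ℕ} {x g : Fin (m + 3) → ℝ}

theorem subgrad_single {n : ℕ} {F : (Fin n → ℝ) → ℝ} {x g : Fin n → ℝ} (hg : g ∈ subgrad F x)
    (j : Fin n) (t : ℝ) : F x + g j * t ≤ F (x + Pi.single j t) := by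
  have h := hg (x + Pi.single j t)
  simpa [Pi.single_apply] using h

theorem subgrad_pyrFun_zero (hg : g ∈ subgrad (pyrFun m) x) (t : ℝ) :
    pyr (x 0) (x 1) (x 2) + g 0 * t ≤ pyr (x 0 + t) (x 1) (x 2) := by
  simpa [pyrFun, Pi.single_apply, (fin_zero_ne_two m).symm] using subgrad_single hg 0 t

theorem subgrad_pyrFun_one (hg : g ∈ subgrad (pyrFun m) x) (t : ℝ) :
    pyr (x 0) (x 1) (x 2) + g 1 * t ≤ pyr (x 0) (x 1 + t) (x 2) := by
  simpa [pyrFun, Pi.single_apply, (fin_one_ne_two m).symm] using subgrad_single hg 1 t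

theorem subgrad_pyrFun_two (hg : g ∈ subgrad (pyrFun m) x) (t : ℝ) :
    pyr (x 0) (x 1) (x 2) + g 2 * t ≤ pyr (x 0) (x 1) (x 2 + t) := by
  simpa [pyrFun, Pi.single_apply, fin_zero_ne_two m, fin_one_ne_two m] using
    subgrad_single hg 2 t

theorem subgrad_pyrFun_rest (hg : g ∈ subgrad (pyrFun m) x) (i : Fin m) :
    g i.succ.succ.succ = 0 := by
  have h : ∀ t, g i.succ.succ.succ * t ≤ 0 := by
    intro t
    have h := subgrad_single hg i.succ.succ.succ t
    have e0 : (0 : Fin (m + 3)) ≠ i.succ.succ.succ := by simp [Fin.ext_iff]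
    have e1 : (1 : Fin (m + 3)) ≠ i.succ.succ.succ := by simp [Fin.ext_iff]
    have e2 : (2 : Fin (m + 3)) ≠ i.succ.succ.succ := by
      intro h
      exact Fin.succ_ne_zero i (Fin.succ_injective _ (Fin.succ_injective _ h.symm))
    simpa [pyrFun, Pi.single_apply, e0, e1, e2] using h
  linarith [h 1, h (-1)]

theorem pyr_swap (a b c : ℝ) : pyr a b c = pyr b a c := by
  unfold pyr; congr 1 <;> ring

theorem pyr_slope_bounds {a b c s : ℝ} (h : ∀ t, pyr a b c + s * t ≤ pyr (a + t) b c) :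
    0 ≤ s ∧ s ≤ 1 ∧ (0 < a → 1 ≤ s) ∧ (max 0 a + max 0 b < a + b + c → 1 ≤ s) ∧
      (a + b + c < max 0 a + max 0 b → a < 0 → s ≤ 0) := by
  refine ⟨?_, ?_, fun ha => ?_, fun hR => ?_, fun hL ha => ?_⟩
  · have h1 := h (-1)
    have h2 := pyr_mono (a := a + -1) (a' := a) (by linarith) (le_refl b) (le_refl c)
    linarith
  · have h1 := h 1
    have h2 := pyr_add_le a b c 1 0 0
    have h3 : pyr 1 0 0 = 1 := by norm_num [pyr]
    rw [add_zero, add_zero, h3] at h2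
    linarith
  · have h1 := h (-a)
    unfold pyr at h1
    rw [max_eq_right ha.le, add_neg_cancel, max_self] at h1
    have h2 : max (a + max 0 b) (a + b + c) = a + max (0 + max 0 b) (0 + b + c) := by
      rw [zero_add, zero_add, add_assoc, max_add_add_left a (max 0 b)]
    nlinarith
  · set d := a + b + c - (max 0 a + max 0 b) with hd
    have hd0 : 0 < d := by linarith
    have h1 := h (-d)
    have h2 : max 0 (a + -d) ≤ max 0 a := max_le_max le_rfl (by linarith)
    rw [pyr_eq_right hR.le, pyr_eq_right (by linarith)] at h1
    nlinarith
  · set d := min (-a) (max 0 a + max 0 b - (a + b + c)) with hd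
    have hd0 : 0 < d := lt_min (by linarith) (by linarith)
    have d1 : d ≤ -a := min_le_left _ _
    have d2 : d ≤ max 0 a + max 0 b - (a + b + c) := min_le_right _ _
    have h1 := h d
    rw [max_eq_left ha.le] at d2 hL
    have e : max 0 (a + d) = 0 := max_eq_left (by linarith)
    rw [pyr_eq_left (by rw [max_eq_left ha.le]; linarith), pyr_eq_left (by rw [e]; linarith), e,
      max_eq_left ha.le] at h1
    nlinarith

theorem pyr_slope_bounds_last {a b c s : ℝ} (h : ∀ t, pyr a b c + s * t ≤ pyr a b (c + t)) :
    0 ≤ s ∧ s ≤ 1 ∧ (max 0 a + max 0 b < a + b + c → 1 ≤ s) ∧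
      (a + b + c < max 0 a + max 0 b → s ≤ 0) := by
  refine ⟨?_, ?_, fun hR => ?_, fun hL => ?_⟩
  · have h1 := h (-1)
    have h2 := pyr_mono (c := c + -1) (c' := c) (le_refl a) (le_refl b) (by linarith)
    linarith
  · have h1 := h 1
    have h2 := pyr_add_le a b c 0 0 1
    have h3 : pyr 0 0 1 = 1 := by norm_num [pyr]
    rw [add_zero, add_zero, h3] at h2
    linarith
  · set d := a + b + c - (max 0 a + max 0 b) with hd
    have hd0 : 0 < d := by linarith
    have h1 := h (-d)
    rw [pyr_eq_right hR.le, pyr_eq_right (by linarith)] at h1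
    nlinarith
  · set d := max 0 a + max 0 b - (a + b + c) with hd
    have hd0 : 0 < d := by linarith
    have h1 := h d
    rw [pyr_eq_left hL.le, pyr_eq_left (by linarith)] at h1
    nlinarith

theorem padVec_mem_subgrad {a b c : ℝ} (hle : ∀ p q r, a * p + b * q + c * r ≤ pyr p q r)
    (heq : a * x 0 + b * x 1 + c * x 2 = pyr (x 0) (x 1) (x 2)) :
    padVec m a b c ∈ subgrad (pyrFun m) x := by
  intro y
  rw [padVec_sum m a b c fun i => y i - x i]
  have := hle (y 0) (y 1) (y 2)
  unfold pyrFun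
  linarith

theorem one_mem_subgrad (h : max 0 (x 0) + max 0 (x 1) ≤ x 0 + x 1 + x 2) :
    padVec m 1 1 1 ∈ subgrad (pyrFun m) x := by
  refine padVec_mem_subgrad (fun p q r => ?_) ?_
  · simp [pyr]
  · rw [pyr_eq_right h]; ring

/-- Slopes of the two rectified linear units give a subgradient off the apex region. -/
theorem slopes_mem_subgrad {a b : ℝ} (h : x 0 + x 1 + x 2 ≤ max 0 (x 0) + max 0 (x 1))
    (ha0 : 0 ≤ a) (ha1 : a ≤ 1) (hb0 : 0 ≤ b) (hb1 : b ≤ 1)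
    (ha : a * x 0 = max 0 (x 0)) (hb : b * x 1 = max 0 (x 1)) :
    padVec m a b 0 ∈ subgrad (pyrFun m) x := by
  have key : ∀ s p : ℝ, 0 ≤ s → s ≤ 1 → s * p ≤ max 0 p := by
    intro s p h0 h1
    rcases le_total p 0 with hp | hp
    · exact le_max_of_le_left (mul_nonpos_of_nonneg_of_nonpos h0 hp)
    · exact le_max_of_le_right (mul_le_of_le_one_left hp h1)
  refine padVec_mem_subgrad (fun p q r => ?_) ?_
  · have h1 : max 0 p + max 0 q ≤ pyr p q r := le_max_left _ _
    linarith [key a p ha0 ha1, key b q hb0 hb1]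
  · rw [pyr_eq_left h, ha, hb]; ring

end Subgradient

theorem pyrFun_isotonicSubgrad (m : ℕ) : IsotonicSubgrad (pyrFun m) := by
  intro x y hxy
  have x0 := hxy 0
  have x1 := hxy 1
  have x2 := hxy 2
  have gap : ∀ {s t : ℝ}, s ≤ t → s - max 0 s ≤ t - max 0 t := by
    intro s t hst
    rcases max_cases 0 s with ⟨h1, _⟩ | ⟨h1, _⟩ <;>
    rcases max_cases 0 t with ⟨h2, _⟩ | ⟨h2, _⟩ <;> linarith
  have g0 := gap x0
  have g1 := gap x1
  constructor
  · intro g hg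
    obtain ⟨p1, p2, -, -, p3⟩ := pyr_slope_bounds (subgrad_pyrFun_zero hg)
    obtain ⟨q1, q2, -, -, q3⟩ := pyr_slope_bounds (a := x 1) (b := x 0) (c := x 2) (s := g 1)
      fun t => by simpa only [pyr_swap _ (x 0)] using subgrad_pyrFun_one hg t
    obtain ⟨r1, r2, -, r3⟩ := pyr_slope_bounds_last (subgrad_pyrFun_two hg)
    have hrest := subgrad_pyrFun_rest hg
    rcases le_or_gt (max 0 (y 0) + max 0 (y 1)) (y 0 + y 1 + y 2) with h | h
    · exact ⟨_, one_mem_subgrad h, forall_fin_add_three p2 q2 r2 fun i => (hrest i).le⟩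
    · have hx : x 0 + x 1 + x 2 < max 0 (x 0) + max 0 (x 1) := by linarith
      refine ⟨padVec m (if 0 ≤ y 0 then 1 else 0) (if 0 ≤ y 1 then 1 else 0) 0,
        slopes_mem_subgrad h.le ?_ ?_ ?_ ?_ ?_ ?_,
        forall_fin_add_three ?_ ?_ (r3 hx) fun i => (hrest i).le⟩
      · split_ifs <;> norm_num
      · split_ifs <;> norm_num
      · split_ifs <;> norm_num
      · split_ifs <;> norm_num
      · split_ifs with h0
        · rw [max_eq_right h0, one_mul]
        · rw [max_eq_left (not_le.1 h0).le, zero_mul]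
      · split_ifs with h0
        · rw [max_eq_right h0, one_mul]
        · rw [max_eq_left (not_le.1 h0).le, zero_mul]
      · rw [padVec_zero]
        split_ifs with h0
        · exact p2
        · exact p3 hx (by linarith)
      · rw [padVec_one]
        split_ifs with h0
        · exact q2
        · exact q3 (by linarith) (by linarith)
  · intro g hg
    obtain ⟨p1, -, p2, p3, -⟩ := pyr_slope_bounds (subgrad_pyrFun_zero hg)
    obtain ⟨q1, -, q2, q3, -⟩ := pyr_slope_bounds (a := y 1) (b := y 0) (c := y 2) (s := g 1)
      fun t => by simpa only [pyr_swap _ (y 0)] using subgrad_pyrFun_one hg t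
    obtain ⟨r1, -, r2, -⟩ := pyr_slope_bounds_last (subgrad_pyrFun_two hg)
    have hrest := subgrad_pyrFun_rest hg
    rcases lt_or_ge (max 0 (x 0) + max 0 (x 1)) (x 0 + x 1 + x 2) with h | h
    · have hy : max 0 (y 0) + max 0 (y 1) < y 0 + y 1 + y 2 := by linarith
      exact ⟨_, one_mem_subgrad h.le, forall_fin_add_three (p3 hy) (q3 (by linarith)) (r2 hy)
        fun i => (hrest i).ge⟩
    · refine ⟨padVec m (if 0 < x 0 then 1 else 0) (if 0 < x 1 then 1 else 0) 0,
        slopes_mem_subgrad h ?_ ?_ ?_ ?_ ?_ ?_,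
        forall_fin_add_three ?_ ?_ r1 fun i => (hrest i).ge⟩
      · split_ifs <;> norm_num
      · split_ifs <;> norm_num
      · split_ifs <;> norm_num
      · split_ifs <;> norm_num
      · split_ifs with h0
        · rw [max_eq_right h0.le, one_mul]
        · rw [max_eq_left (not_lt.1 h0), zero_mul]
      · split_ifs with h0
        · rw [max_eq_right h0.le, one_mul]
        · rw [max_eq_left (not_lt.1 h0), zero_mul]
      · rw [padVec_zero]
        split_ifs with h0
        · exact p2 (by linarith)
        · exact p1
      · rw [padVec_one]
        split_ifs with h0
        · exact q2 (by linarith)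
        · exact q1

/-- For every `n ≥ 3` there is a CPWL, homogeneous, monotone, convex function
`F : ℝⁿ → ℝ` with isotonic subgradient which is not computable by any monotone ReLU network. -/
theorem exists_isotonic_not_in_ReLUplus :
    ∀ n : ℕ, 3 ≤ n → ∃ F : (Fin n → ℝ) → ℝ,
      IsCPWL F ∧
      (∀ a : ℝ, 0 ≤ a → ∀ x : Fin n → ℝ, F (a • x) = a * F x) ∧
      Monotone F ∧
      ConvexOn ℝ Set.univ F ∧
      IsotonicSubgrad F ∧
      ∀ k : ℕ, ¬ ReLUplus n k F := by
  intro n hn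
  obtain ⟨m, rfl⟩ := Nat.exists_eq_add_of_le' hn
  exact ⟨pyrFun m, pyrFun_isCPWL m, fun a ha x => pyr_smul ha (x 0) (x 1) (x 2),
    fun x y h => pyr_mono (h 0) (h 1) (h 2), pyrFun_convexOn m, pyrFun_isotonicSubgrad m,
    pyrFun_not_ReLUplus m⟩
end
end

section
/- For every n > 0 and every k < n, the function m_n does not belong to ReLU⁺_{n,k}; that is, every monotone ReLU network computing m_n has depth at least n. -/
noncomputable section

/-- The functions `m_n`, defined by `m_0 = 0` and
`m_n (x) = relu (x_n + m_{n-1} (x_1, …, x_{n-1}))`. -/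
def mfun : (n : ℕ) → (Fin n → ℝ) → ℝ
  | 0, _ => 0
  | n + 1, x => relu (x (Fin.last n) + mfun n (fun i => x (Fin.castSucc i)))

theorem relu_mul {t : ℝ} (ht : 0 ≤ t) (s : ℝ) : relu (t * s) = t * relu s := by
  simp [relu, mul_max_of_nonneg _ _ ht]

namespace ReLUplus

variable {n k : ℕ} {F : (Fin n → ℝ) → ℝ}

/-- Monotone ReLU networks compute monotone functions. -/
theorem monotone_s7 (hF : ReLUplus n k F) : Monotone F := by
  induction hF with
  | affine a b ha =>
    intro x y hxy
    have := Finset.sum_le_sum fun i (_ : i ∈ Finset.univ) =>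
      mul_le_mul_of_nonneg_left (hxy i) (ha i)
    simpa using this
  | comb c c' b hc hc' _ _ ihF ihG =>
    intro x y hxy
    have h1 := mul_le_mul_of_nonneg_left (ihF hxy) hc
    have h2 := mul_le_mul_of_nonneg_left (ihG hxy) hc'
    dsimp only
    linarith
  | act _ ih => exact relu_mono.comp ih
  | deepen _ ih => exact ih

/-- Monotone ReLU networks compute convex functions. -/
theorem convexOn_s7 (hF : ReLUplus n k F) : ConvexOn ℝ Set.univ F := by
  induction hF with
  | affine a b ha =>
    refine ⟨convex_univ, fun x _ y _ s t _ _ hst => le_of_eq ?_⟩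
    simp only [Pi.add_apply, Pi.smul_apply, smul_eq_mul, mul_add, Finset.sum_add_distrib,
      Finset.mul_sum, mul_left_comm (a _)]
    linear_combination (-b) * hst
  | comb c c' b hc hc' _ _ ihF ihG =>
    exact ((ihF.smul hc).add (ihG.smul hc')).add_const b
  | act _ ih => exact (convexOn_const 0 convex_univ).sup ih
  | deepen _ ih => exact ih

/-- Fixing the last input of a monotone ReLU network gives a monotone ReLU network of the same
depth. -/
theorem fix_last {F : (Fin (n + 1) → ℝ) → ℝ} (hF : ReLUplus (n + 1) k F) (t : ℝ) :
    ReLUplus n k fun x => F (Fin.snoc x t) := by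
  induction hF with
  | affine a b ha =>
    simpa [Fin.sum_univ_castSucc, add_assoc] using
      ReLUplus.affine (fun i => a i.castSucc) (a (Fin.last n) * t + b) fun i => ha _
  | comb c c' b hc hc' _ _ ihF ihG => exact ihF.comb c c' b hc hc' ihG
  | act _ ih => exact ih.act
  | deepen _ ih => exact ih.deepen

end ReLUplus

theorem mfun_nonneg : ∀ (n : ℕ) (x : Fin n → ℝ), 0 ≤ mfun n x
  | 0, _ => le_rfl
  | _ + 1, _ => le_max_left _ _

theorem mfun_mono : ∀ n : ℕ, Monotone (mfun n)
  | 0, _, _, _ => le_rfl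
  | n + 1, _, _, h => relu_mono (add_le_add (h _) (mfun_mono n fun i => h i.castSucc))

theorem mfun_smul {t : ℝ} (ht : 0 ≤ t) : ∀ (n : ℕ) (x : Fin n → ℝ), mfun n (t • x) = t * mfun n x
  | 0, _ => by simp [mfun]
  | n + 1, x => by
    rw [mfun, mfun, ← relu_mul ht, mul_add, ← mfun_smul ht n]
    rfl

theorem mfun_zero (n : ℕ) : mfun n 0 = 0 := by
  simpa using mfun_smul le_rfl n 0

theorem mfun_single_last (n : ℕ) (t : ℝ) :
    mfun (n + 1) (Pi.single (Fin.last n) t) = relu t := by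
  have h : (fun i : Fin n => Pi.single (M := fun _ => ℝ) (Fin.last n) t i.castSucc) = 0 := by
    ext i
    simp
  rw [mfun, h, mfun_zero]
  simp

theorem mfun_sub_single_last (n : ℕ) (x : Fin (n + 1) → ℝ) :
    mfun (n + 1) (x - Pi.single (Fin.last n) (mfun (n + 1) x)) = 0 := by
  have h : x (Fin.last n) + mfun n (fun i => x i.castSucc) ≤ mfun (n + 1) x := le_max_right _ _
  rw [mfun, relu, max_eq_left]
  simp only [Pi.sub_apply, Pi.single_eq_same, ne_eq, Fin.castSucc_ne_last, not_false_eq_true,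
    Pi.single_eq_of_ne, sub_zero]
  linarith

theorem mfun_snoc_of_nonneg (n : ℕ) (x : Fin n → ℝ) {t : ℝ} (ht : 0 ≤ t) :
    mfun (n + 1) (Fin.snoc x t) = t + mfun n x := by
  have := mfun_nonneg n x
  simp only [mfun, Fin.snoc_last, Fin.snoc_castSucc, relu]
  exact max_eq_right (by positivity)

/-- If two convex functions have a sum satisfying the equality case of Jensen's inequality at some
points, then so does each summand. -/
theorem ConvexOn.eq_of_add_eq {E : Type*} [AddCommGroup E] [Module ℝ E] {F G : E → ℝ}
    (hF : ConvexOn ℝ Set.univ F) (hG : ConvexOn ℝ Set.univ G) {x y : E} {s t : ℝ}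
    (hs : 0 ≤ s) (ht : 0 ≤ t) (hst : s + t = 1)
    (h : F (s • x + t • y) + G (s • x + t • y) = s * (F x + G x) + t * (F y + G y)) :
    F (s • x + t • y) = s * F x + t * F y := by
  have h1 := hF.2 (Set.mem_univ x) (Set.mem_univ y) hs ht hst
  have h2 := hG.2 (Set.mem_univ x) (Set.mem_univ y) hs ht hst
  simp only [smul_eq_mul] at h1 h2
  linarith

/-- The function `m_n` is indecomposable: monotone convex summands of `α * m_n + b` are again of
this form. -/
theorem eq_mfun_of_add_eq_mfun {n : ℕ} {F G : (Fin (n + 1) → ℝ) → ℝ} {α b : ℝ}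
    (hF : Monotone F) (hG : Monotone G)
    (hFc : ConvexOn ℝ Set.univ F) (hGc : ConvexOn ℝ Set.univ G)
    (h : ∀ x, F x + G x = α * mfun (n + 1) x + b) (x : Fin (n + 1) → ℝ) :
    F x = (F (Pi.single (Fin.last n) 1) - F 0) * mfun (n + 1) x + F 0 := by
  have tight {x y : Fin (n + 1) → ℝ} {s t : ℝ} (hs : 0 ≤ s) (ht : 0 ≤ t) (hst : s + t = 1)
      (hm : mfun (n + 1) (s • x + t • y) = s * mfun (n + 1) x + t * mfun (n + 1) y) :
      F (s • x + t • y) = s * F x + t * F y := by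
    refine hFc.eq_of_add_eq hGc hs ht hst ?_
    rw [h, h, h, hm]
    linear_combination (-b) * hst
  have homog {s : ℝ} (hs : 0 ≤ s) (hs1 : s ≤ 1) (y : Fin (n + 1) → ℝ) :
      F (s • y) = s * F y + (1 - s) * F 0 := by
    have := tight (x := y) (y := 0) hs (sub_nonneg.2 hs1) (by ring)
      (by simp [mfun_smul hs, mfun_zero])
    simpa using this
  have const {y z : Fin (n + 1) → ℝ} (hyz : y ≤ z) (hz : mfun (n + 1) z = 0) : F y = F z := by
    have hy : mfun (n + 1) y = 0 := le_antisymm (hz ▸ mfun_mono _ hyz) (mfun_nonneg _ _)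
    have := h y
    have := h z
    have := hF hyz
    have := hG hyz
    rw [hy] at *
    rw [hz] at *
    linarith
  set m := mfun (n + 1) x with hm
  have hm0 : 0 ≤ m := mfun_nonneg _ _
  have hz := mfun_sub_single_last n x
  rw [← hm] at hz
  have hFz : F (x - Pi.single (Fin.last n) m) = F 0 :=
    (const inf_le_left hz).symm.trans (const inf_le_right (mfun_zero _))
  have hFx : F x = F (Pi.single (Fin.last n) m) := by
    have hhalf : (1 / 2 : ℝ) • (x - Pi.single (Fin.last n) m) +
        (1 / 2 : ℝ) • Pi.single (Fin.last n) m = (1 / 2 : ℝ) • x := by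
      rw [smul_sub, sub_add_cancel]
    have h1 := tight (x := x - Pi.single (Fin.last n) m) (y := Pi.single (Fin.last n) m)
      (s := 1 / 2) (t := 1 / 2) (by norm_num) (by norm_num) (by norm_num) (by
        rw [hhalf, mfun_smul (by norm_num), hz, mfun_single_last, relu, max_eq_right hm0, ← hm]
        ring)
    have h2 := homog (s := 1 / 2) (by norm_num) (by norm_num) x
    rw [hhalf] at h1
    linarith
  have hsingle (s : ℝ) (t : ℝ) :
      s • (Pi.single (Fin.last n) t : Fin (n + 1) → ℝ) = Pi.single (Fin.last n) (s * t) := by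
    rw [← Pi.single_smul, smul_eq_mul]
  rw [hFx]
  rcases le_total m 1 with h1 | h1
  · have := homog hm0 h1 (Pi.single (Fin.last n) 1)
    rw [hsingle, mul_one] at this
    linarith
  · have hpos : 0 < m := by linarith
    have := homog (inv_nonneg.2 hm0) (inv_le_one_of_one_le₀ h1) (Pi.single (Fin.last n) m)
    rw [hsingle, inv_mul_cancel₀ hpos.ne'] at this
    rw [this]
    field_simp
    ring

/-- No monotone ReLU network of depth less than `n` computes `α * m_n + b` with `α > 0`. -/
theorem ReLUplus.ne_mul_mfun_add {n k : ℕ} {F : (Fin n → ℝ) → ℝ} (hF : ReLUplus n k F)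
    (hk : k < n) {α : ℝ} (hα : 0 < α) (b : ℝ) : ¬ ∀ x, F x = α * mfun n x + b := by
  induction n generalizing k α b with
  | zero => omega
  | succ n ihn =>
    induction hF generalizing α b with
    | affine a d ha =>
      intro h
      have h0 := h 0
      have h1 := h (Pi.single (Fin.last n) 1)
      have h2 := h (Pi.single (Fin.last n) (-1))
      rw [mfun_single_last] at h1 h2
      rw [mfun_zero] at h0
      simp [Pi.single_apply, relu] at h0 h1 h2
      linarith
    | @comb k F G c c' d hc hc' hF hG ihF ihG =>
      intro h
      have hsum x : (c • F) x + (c' • G) x = α * mfun (n + 1) x + (b - d) := by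
        have := h x
        simp only [Pi.smul_apply, smul_eq_mul]
        linarith
      have hFm : Monotone (c • F) := fun _ _ h => mul_le_mul_of_nonneg_left (hF.monotone_s7 h) hc
      have hGm : Monotone (c' • G) := fun _ _ h => mul_le_mul_of_nonneg_left (hG.monotone_s7 h) hc'
      have hFe := eq_mfun_of_add_eq_mfun hFm hGm (hF.convexOn_s7.smul hc) (hG.convexOn_s7.smul hc') hsum
      have hGe := eq_mfun_of_add_eq_mfun hGm hFm (hG.convexOn_s7.smul hc') (hF.convexOn_s7.smul hc)
        fun x => (add_comm _ _).trans (hsum x)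
      have slope_nonpos {H : (Fin (n + 1) → ℝ) → ℝ} {r δ e : ℝ} (hr : 0 ≤ r)
          (ih : ∀ {α : ℝ}, 0 < α → ∀ b, ¬ ∀ x, H x = α * mfun (n + 1) x + b)
          (hH : ∀ x, (r • H) x = δ * mfun (n + 1) x + e) : δ ≤ 0 := by
        by_contra! hδ
        rcases hr.eq_or_lt with rfl | hr
        · have h0 := hH 0
          have h1 := hH (Pi.single (Fin.last n) 1)
          rw [mfun_zero] at h0
          rw [mfun_single_last] at h1
          simp [relu] at h0 h1
          linarith
        · refine ih (div_pos hδ hr) (e / r) fun x => ?_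
          have := hH x
          simp only [Pi.smul_apply, smul_eq_mul] at this
          field_simp
          linarith
      have h1 := slope_nonpos hc (ihF hk) hFe
      have h2 := slope_nonpos hc' (ihG hk) hGe
      have h3 := hsum 0
      have h4 := hsum (Pi.single (Fin.last n) 1)
      rw [mfun_zero] at h3
      rw [mfun_single_last, relu, max_eq_right zero_le_one] at h4
      linarith
    | @act k F hF ih =>
      intro h
      have hb : 0 ≤ b := by
        have := h 0
        rw [mfun_zero, mul_zero, zero_add] at this
        exact this ▸ le_max_left _ _
      refine ihn (hF.fix_last 1) (by omega) hα (α + b) fun x => ?_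
      have hx := h (Fin.snoc x 1)
      have := mul_nonneg hα.le (mfun_nonneg n x)
      rw [mfun_snoc_of_nonneg n x zero_le_one] at hx
      change max 0 (F (Fin.snoc x 1)) = _ at hx
      rcases max_choice 0 (F (Fin.snoc x 1)) with h0 | h0 <;> rw [h0] at hx <;> linarith
    | deepen _ ih => exact ih (by omega) hα b

/-- For every `n > 0` and `k < n`, `m_n` is not computable by a depth-`k`
monotone ReLU network; every monotone ReLU network computing `m_n` has depth at least `n`. -/
theorem mfun_not_in_ReLUplus_shallow :
    ∀ n : ℕ, 0 < n → ∀ k : ℕ, k < n → ¬ ReLUplus n k (mfun n) := by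
  intro n _ k hk h
  exact h.ne_mul_mfun_add hk one_pos 0 fun x => by simp
end
end
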